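/- Let H be a real Hilbert space, c ∈ (0,1), and let E ⊆ H be a c-porous set. Then for every open ball U in Γ₁(H) there exists an open ball V in Γ₁(H) with V ⊆ U such that sup_{f∈V} |f⁻¹(E)| ≤ (1/2) · sup_{f∈U} |f⁻¹(E)|, where |f⁻¹(E)| denotes the outer Lebesgue measure of {t ∈ [0,1] : f(t) ∈ E}. -/

import Mathlib

open Set MeasureTheory Metric Topology
open scoped ENNReal

noncomputable section

/-- The space `Γ₁(H)` of `C¹` curves `[0,1] → H`, encoded as pairs
`(γ, γ')` of continuous maps such that `γ'` is the (one-sided at the endpoints)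
derivative of `γ` on `[0,1]`. -/
def Gamma1 (H : Type*) [NormedAddCommGroup H] [NormedSpace ℝ H] : Type _ :=
  {p : C(Icc (0:ℝ) 1, H) × C(Icc (0:ℝ) 1, H) //
    ∀ t ∈ Icc (0:ℝ) 1,
      HasDerivWithinAt (IccExtend zero_le_one ⇑p.1) (IccExtend zero_le_one ⇑p.2 t) (Icc 0 1) t}

/-- The metric on `Γ₁(H)` induced by the norm `‖γ‖_∞ + ‖γ'‖_∞`. -/
noncomputable instance Gamma1.metricSpace (H : Type*) [NormedAddCommGroup H]
    [NormedSpace ℝ H] : MetricSpace (Gamma1 H) where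
  dist f g := ‖f.1.1 - g.1.1‖ + ‖f.1.2 - g.1.2‖
  dist_self f := by simp
  dist_comm f g := by
    simp only [norm_sub_rev f.1.1 g.1.1, norm_sub_rev f.1.2 g.1.2]
  dist_triangle f g h := by
    change ‖f.1.1 - h.1.1‖ + ‖f.1.2 - h.1.2‖ ≤
      (‖f.1.1 - g.1.1‖ + ‖f.1.2 - g.1.2‖) + (‖g.1.1 - h.1.1‖ + ‖g.1.2 - h.1.2‖)
    have h1 := dist_triangle f.1.1 g.1.1 h.1.1
    have h2 := dist_triangle f.1.2 g.1.2 h.1.2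
    simp only [dist_eq_norm] at h1 h2
    linarith
  eq_of_dist_eq_zero := by
    intro f g hfg
    change ‖f.1.1 - g.1.1‖ + ‖f.1.2 - g.1.2‖ = 0 at hfg
    have n1 := norm_nonneg (f.1.1 - g.1.1)
    have n2 := norm_nonneg (f.1.2 - g.1.2)
    have e1 : ‖f.1.1 - g.1.1‖ = 0 := by linarith
    have e2 : ‖f.1.2 - g.1.2‖ = 0 := by linarith
    have q1 : f.1.1 = g.1.1 := sub_eq_zero.mp (norm_eq_zero.mp e1)
    have q2 : f.1.2 = g.1.2 := sub_eq_zero.mp (norm_eq_zero.mp e2)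
    exact Subtype.ext (Prod.ext q1 q2)

/-- The outer Lebesgue measure of the set of times `t ∈ [0,1]` at which a curve
`γ ∈ Γ₁(H)` lies in the set `E`. -/
def Gamma1.measOn {H : Type*} [NormedAddCommGroup H] [NormedSpace ℝ H]
    (γ : Gamma1 H) (E : Set H) : ℝ≥0∞ :=
  volume (Subtype.val '' (⇑γ.1.1 ⁻¹' E))


/-- `E` is `c`-porous: at every point `x ∈ E` and every scale `ε > 0` there is a hole
`B(h,r)` of `E` with `d(x,h) < ε` and `r > c · d(x,h)`. -/
def IsCPorous {M : Type*} [MetricSpace M] (c : ℝ) (E : Set M) : Prop :=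
  ∀ x ∈ E, ∀ ε > 0, ∃ h : M, ∃ r > 0,
    dist x h < ε ∧ Metric.ball h r ∩ E = ∅ ∧ r > c * dist x h

namespace Gamma1

section Basic

variable {H : Type*} [NormedAddCommGroup H] [NormedSpace ℝ H]

/-- The curve `f`, extended to `ℝ` by constants. -/
def path (f : Gamma1 H) : ℝ → H := IccExtend zero_le_one ⇑f.1.1

/-- The derivative of the curve `f`, extended to `ℝ` by constants. -/
def velocity (f : Gamma1 H) : ℝ → H := IccExtend zero_le_one ⇑f.1.2

lemma continuous_path (f : Gamma1 H) : Continuous f.path := f.1.1.continuous.Icc_extend'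

lemma continuous_velocity (f : Gamma1 H) : Continuous f.velocity := f.1.2.continuous.Icc_extend'

lemma hasDerivWithinAt_path (f : Gamma1 H) {t : ℝ} (ht : t ∈ Icc (0:ℝ) 1) :
    HasDerivWithinAt f.path (f.velocity t) (Icc 0 1) t := f.2 t ht

lemma dist_eq (f g : Gamma1 H) : dist f g = ‖f.1.1 - g.1.1‖ + ‖f.1.2 - g.1.2‖ := rfl

lemma norm_path_sub_le (f g : Gamma1 H) (t : ℝ) :
    ‖f.path t - g.path t‖ ≤ ‖f.1.1 - g.1.1‖ :=
  (f.1.1 - g.1.1).norm_coe_le_norm (projIcc 0 1 zero_le_one t)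

lemma norm_velocity_sub_le (f g : Gamma1 H) (t : ℝ) :
    ‖f.velocity t - g.velocity t‖ ≤ ‖f.1.2 - g.1.2‖ :=
  (f.1.2 - g.1.2).norm_coe_le_norm (projIcc 0 1 zero_le_one t)

lemma norm_fst_sub_le {f g : Gamma1 H} {a : ℝ} (ha : 0 ≤ a)
    (h : ∀ t ∈ Icc (0:ℝ) 1, ‖f.path t - g.path t‖ ≤ a) : ‖f.1.1 - g.1.1‖ ≤ a := by
  refine (ContinuousMap.norm_le _ ha).2 fun t => ?_
  simpa [path, IccExtend_of_mem _ _ t.2] using h t t.2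

lemma norm_snd_sub_le {f g : Gamma1 H} {a : ℝ} (ha : 0 ≤ a)
    (h : ∀ t ∈ Icc (0:ℝ) 1, ‖f.velocity t - g.velocity t‖ ≤ a) : ‖f.1.2 - g.1.2‖ ≤ a := by
  refine (ContinuousMap.norm_le _ ha).2 fun t => ?_
  simpa [velocity, IccExtend_of_mem _ _ t.2] using h t t.2

/-- Every `C¹` function on `[0,1]` is the path of an element of `Γ₁(H)`. -/
lemma exists_of_hasDerivWithinAt {F F' : ℝ → H} (hF : Continuous F) (hF' : Continuous F')
    (h : ∀ t ∈ Icc (0:ℝ) 1, HasDerivWithinAt F (F' t) (Icc 0 1) t) :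
    ∃ g : Gamma1 H, ∀ t ∈ Icc (0:ℝ) 1, g.path t = F t ∧ g.velocity t = F' t := by
  refine ⟨⟨(⟨fun t => F t, by fun_prop⟩, ⟨fun t => F' t, by fun_prop⟩), fun t ht => ?_⟩,
    fun t ht => ⟨?_, ?_⟩⟩
  · rw [IccExtend_of_mem _ _ ht]
    exact (h t ht).congr (fun x hx => by rw [IccExtend_of_mem _ _ hx]; rfl)
      (by rw [IccExtend_of_mem _ _ ht]; rfl)
  · exact IccExtend_of_mem _ _ ht
  · exact IccExtend_of_mem _ _ ht

/-- The set of times in `[0,1]` at which `f` lies in `E`. -/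
def times (f : Gamma1 H) (E : Set H) : Set ℝ := {t ∈ Icc (0:ℝ) 1 | f.path t ∈ E}

lemma measOn_eq (f : Gamma1 H) (E : Set H) : f.measOn E = volume (f.times E) := by
  unfold measOn times
  congr 1
  ext t
  constructor
  · rintro ⟨x, hx, rfl⟩
    exact ⟨x.2, by simpa [path, IccExtend_of_mem _ _ x.2] using hx⟩
  · rintro ⟨ht, h⟩
    exact ⟨⟨t, ht⟩, by simpa [path, IccExtend_of_mem _ _ ht] using h, rfl⟩

lemma times_subset (f : Gamma1 H) (E : Set H) : f.times E ⊆ Icc 0 1 := fun _ h => h.1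

lemma volume_times_le (f : Gamma1 H) (E : Set H) : volume (f.times E) ≤ 1 := by
  simpa using measure_mono (μ := volume) (f.times_subset E)

lemma norm_path_sub_path_le (f : Gamma1 H) {L : ℝ} (hL : ∀ t, ‖f.velocity t‖ ≤ L) {s t : ℝ}
    (hs : s ∈ Icc (0:ℝ) 1) (ht : t ∈ Icc (0:ℝ) 1) : ‖f.path t - f.path s‖ ≤ L * |t - s| :=
  Convex.norm_image_sub_le_of_norm_hasDerivWithin_le
    (fun _ hx => f.hasDerivWithinAt_path hx) (fun x _ => hL x) (convex_Icc 0 1) hs ht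

/-- The energy of the velocity difference of two curves. -/
def energy (f g : Gamma1 H) : ℝ := ∫ t in (0:ℝ)..1, ‖f.velocity t - g.velocity t‖ ^ 2

lemma energy_nonneg (f g : Gamma1 H) : 0 ≤ energy f g :=
  intervalIntegral.integral_nonneg zero_le_one fun _ _ => by positivity

lemma energy_le_add {f g k : Gamma1 H} {R r : ℝ} (hfg : ‖f.1.2 - g.1.2‖ ≤ R)
    (hkf : ‖k.1.2 - f.1.2‖ ≤ r) : energy k g ≤ energy f g + (2 * R * r + r ^ 2) := by
  have hc := f.continuous_velocity
  have hc' := g.continuous_velocity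
  have hc'' := k.continuous_velocity
  have hr : 0 ≤ r := (norm_nonneg _).trans hkf
  have hR : 0 ≤ R := (norm_nonneg _).trans hfg
  have : energy f g + (2 * R * r + r ^ 2) =
      ∫ t in (0:ℝ)..1, (‖f.velocity t - g.velocity t‖ ^ 2 + (2 * R * r + r ^ 2)) := by
    rw [intervalIntegral.integral_add (Continuous.intervalIntegrable (by fun_prop) _ _)
      (by simp)]
    simp [energy]
  rw [this]
  refine intervalIntegral.integral_mono_on zero_le_one
    (Continuous.intervalIntegrable (by fun_prop) _ _)
    (Continuous.intervalIntegrable (by fun_prop) _ _) fun t _ => ?_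
  have h1 := (norm_velocity_sub_le f g t).trans hfg
  have h2 := (norm_velocity_sub_le k f t).trans hkf
  have h3 := norm_sub_le_norm_sub_add_norm_sub (k.velocity t) (f.velocity t) (g.velocity t)
  have h4 := norm_nonneg (f.velocity t - g.velocity t)
  have h5 := norm_nonneg (k.velocity t - g.velocity t)
  have h6 := norm_nonneg (k.velocity t - f.velocity t)
  nlinarith [mul_le_mul h1 h2 h6 hR, mul_le_mul h2 h2 h6 hr]

lemma mul_volume_velocity_ge_le (f g : Gamma1 H) {a : ℝ} (ha : 0 ≤ a) :
    a ^ 2 * volume.real {t ∈ Icc (0:ℝ) 1 | a ≤ ‖f.velocity t - g.velocity t‖} ≤ energy f g := by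
  have hc := f.continuous_velocity
  have hc' := g.continuous_velocity
  have h := mul_meas_ge_le_integral_of_nonneg (μ := volume.restrict (Icc (0:ℝ) 1))
    (f := fun t => ‖f.velocity t - g.velocity t‖ ^ 2)
    (Filter.Eventually.of_forall fun t => by positivity)
    (Continuous.integrableOn_Icc (by fun_prop)) (a ^ 2)
  rw [energy, intervalIntegral.integral_of_le zero_le_one, ← integral_Icc_eq_integral_Ioc]
  convert h using 2
  rw [measureReal_restrict_apply' measurableSet_Icc]
  congr 1
  ext t
  simp only [mem_ofPred_eq, mem_inter_iff, and_comm, pow_le_pow_iff_left₀ ha (norm_nonneg _)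
    two_ne_zero]

end Basic

end Gamma1

/-- A `C¹` cutoff vanishing on a closed set and equal to `1` off a neighbourhood of it. -/
lemma exists_cutoff {A W : Set ℝ} (hA : IsClosed A) (hW : IsOpen W) (hAW : A ⊆ W) :
    ∃ (χ : ℝ → ℝ) (C : ℝ), 0 ≤ C ∧ ContDiff ℝ 1 χ ∧ (∀ t, |χ t| ≤ 1) ∧
      (∀ t ∈ A, χ t = 0) ∧ (∀ t ∉ W, χ t = 1) ∧ ∀ t ∈ Icc (0:ℝ) 1, |deriv χ t| ≤ C := by
  obtain ⟨χ, h0, h1, h⟩ := exists_contMDiffMap_zero_one_of_isClosed (n := 1)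
    (modelWithCornersSelf ℝ ℝ) hA hW.isClosed_compl (disjoint_compl_right_iff_subset.2 hAW)
  have hχ : ContDiff ℝ 1 χ := χ.contMDiff.contDiff
  obtain ⟨C, hC⟩ := (isCompact_Icc (a := (0:ℝ)) (b := 1)).exists_bound_of_continuousOn
    (hχ.continuous_deriv le_rfl).continuousOn
  refine ⟨χ, C, (norm_nonneg _).trans (hC 0 (by simp)), hχ, fun t => ?_, fun t ht => h0 ht,
    fun t ht => h1 ht, hC⟩
  rw [abs_of_nonneg (h t).1]
  exact (h t).2

/-- A `C¹` bump function on the line. -/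
lemma exists_bump : ∃ (ψ : ℝ → ℝ) (K : ℝ), 1 ≤ K ∧ ContDiff ℝ 1 ψ ∧ (∀ x, |ψ x| ≤ 1) ∧
    (∀ x, |deriv ψ x| ≤ K) ∧ (∀ x, |x| ≤ 1 / 2 → ψ x = 1) ∧ (∀ x, 1 ≤ |x| → ψ x = 0) ∧
      ∀ x, 1 < |x| → deriv ψ x = 0 := by
  let b : ContDiffBump (0:ℝ) := ⟨1 / 2, 1, by norm_num, by norm_num⟩
  have hb : ContDiff ℝ 1 b := b.contDiff
  obtain ⟨K, hK⟩ := (hb.continuous_deriv le_rfl).bounded_above_of_compact_support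
    b.hasCompactSupport.deriv
  refine ⟨b, max K 1, le_max_right _ _, hb, fun x => ?_, fun x => (hK x).trans (le_max_left _ _),
    fun x hx => b.one_of_mem_closedBall (by simpa [b] using hx),
    fun x hx => b.zero_of_le_dist (by simpa [b] using hx), fun x hx => ?_⟩
  · rw [abs_of_nonneg b.nonneg]
    exact b.le_one
  · by_contra h
    have := support_deriv_subset h
    rw [b.tsupport_eq] at this
    simp [b] at this
    linarith

/-- A finite version of the Besicovitch covering theorem on the line. -/
lemma exists_finset_disjoint_closedBall {G : Set ℝ} {rad : ℝ → Set ℝ} {R : ℝ → ℝ} {b : ℝ≥0∞}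
    (hb : b < volume G) (hrad : ∀ x ∈ G, ∀ δ > 0, (rad x ∩ Ioo 0 δ).Nonempty)
    (hR : ∀ x ∈ G, 0 < R x) :
    ∃ (T : Finset ℝ) (w : ℝ → ℝ), (∀ x ∈ T, x ∈ G) ∧ (∀ x ∈ T, w x ∈ rad x ∩ Ioo 0 (R x)) ∧
      (T : Set ℝ).PairwiseDisjoint (fun x => closedBall x (w x)) ∧
      b < volume (⋃ x ∈ T, closedBall x (w x)) := by
  obtain ⟨t, w, htc, htG, hw, hcov, hdisj⟩ :=
    Besicovitch.exists_disjoint_closedBall_covering_ae volume rad G hrad R hR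
  have h1 : volume G ≤ volume (⋃ x ∈ t, closedBall x (w x)) := by
    refine (measure_mono (subset_sdiff_union G (⋃ x ∈ t, closedBall x (w x)))).trans ((measure_union_le _ _).trans ?_)
    rw [hcov, zero_add]
  rw [measure_biUnion htc hdisj fun _ _ => isClosed_closedBall.measurableSet,
    ENNReal.tsum_eq_iSup_sum] at h1
  obtain ⟨F, hF⟩ := lt_iSup_iff.1 (hb.trans_le h1)
  have hsub : ∀ x ∈ F.map (Function.Embedding.subtype _), x ∈ t := by
    intro x hx
    obtain ⟨y, -, rfl⟩ := Finset.mem_map.1 hx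
    exact y.2
  refine ⟨F.map (Function.Embedding.subtype _), w, fun x hx => htG (hsub x hx),
    fun x hx => hw x (hsub x hx), hdisj.subset hsub, ?_⟩
  rw [measure_biUnion_finset (hdisj.subset hsub) fun _ _ => isClosed_closedBall.measurableSet,
    Finset.sum_map]
  exact hF

lemma volume_real_biUnion_closedBall {T : Finset ℝ} {w : ℝ → ℝ} (hw : ∀ x ∈ T, 0 ≤ w x)
    (h : (T : Set ℝ).PairwiseDisjoint (fun x => closedBall x (w x))) :
    volume.real (⋃ x ∈ T, closedBall x (w x)) = ∑ x ∈ T, 2 * w x := by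
  rw [measureReal_biUnion_finset h (fun _ _ => isClosed_closedBall.measurableSet)
    fun _ _ => measure_closedBall_lt_top.ne]
  exact Finset.sum_congr rfl fun x hx => Real.volume_real_closedBall (hw x hx)

lemma sum_volume_real_inter_closedBall {T : Finset ℝ} {w : ℝ → ℝ} (S : Set ℝ)
    (h : (T : Set ℝ).PairwiseDisjoint (fun x => closedBall x (w x))) :
    ∑ x ∈ T, volume.real (S ∩ closedBall x (w x)) =
      volume.real (S ∩ ⋃ x ∈ T, closedBall x (w x)) := by
  have hm : ∀ x ∈ T, MeasurableSet (closedBall x (w x)) := fun _ _ =>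
    isClosed_closedBall.measurableSet
  have hfin : ∀ x ∈ T, volume.restrict S (closedBall x (w x)) ≠ ∞ := fun _ _ =>
    ((Measure.restrict_apply_le _ _).trans_lt measure_closedBall_lt_top).ne
  have := measureReal_biUnion_finset (μ := volume.restrict S) h hm hfin
  rw [measureReal_restrict_apply (T.measurableSet_biUnion hm), inter_comm] at this
  rw [this]
  exact Finset.sum_congr rfl fun x hx => by
    rw [measureReal_restrict_apply (hm x hx), inter_comm]

namespace Gamma1

section Glue

variable {H : Type*} [NormedAddCommGroup H] [NormedSpace ℝ H]

/-- If `g` agrees with `f` off `W`, then every curve close to `g` can be modified to a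
curve close to `f`, without changing it off `W`, and so that it equals `f` on `A`. -/
lemma exists_glue {f g : Gamma1 H} {A W : Set ℝ} (hA : IsClosed A) (hW : IsOpen W) (hAW : A ⊆ W)
    (hfg : ∀ t ∈ Icc (0:ℝ) 1, t ∉ W → g.path t = f.path t) {σ₀ : ℝ} (hσ₀ : 0 < σ₀) :
    ∃ σ > 0, ∀ k ∈ ball g σ, ∃ p ∈ ball f σ₀,
      (∀ t ∈ Icc (0:ℝ) 1, t ∈ A → p.path t = f.path t) ∧
      ∀ t ∈ Icc (0:ℝ) 1, t ∉ W → p.path t = k.path t := by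
  obtain ⟨χ, C, hC0, hχ, hχ1, hχA, hχW, hC⟩ := exists_cutoff hA hW hAW
  refine ⟨σ₀ / (1 + C), by positivity, fun k hk => ?_⟩
  have cf := f.continuous_path
  have cg := g.continuous_path
  have ck := k.continuous_path
  have cf' := f.continuous_velocity
  have cg' := g.continuous_velocity
  have ck' := k.continuous_velocity
  have cχ := hχ.continuous
  have cχ' := hχ.continuous_deriv le_rfl
  obtain ⟨p, hp⟩ := exists_of_hasDerivWithinAt
    (F := fun t => f.path t + χ t • (k.path t - g.path t))
    (F' := fun t => f.velocity t +
      (χ t • (k.velocity t - g.velocity t) + deriv χ t • (k.path t - g.path t)))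
    (by fun_prop) (by fun_prop) fun t ht => by
      have h1 : HasDerivWithinAt χ (deriv χ t) (Icc 0 1) t :=
        ((hχ.differentiable one_ne_zero) t).hasDerivAt.hasDerivWithinAt
      exact (f.hasDerivWithinAt_path ht).add
        (h1.smul ((k.hasDerivWithinAt_path ht).sub (g.hasDerivWithinAt_path ht)))
  refine ⟨p, ?_, fun t ht htA => ?_, fun t ht htW => ?_⟩
  · rw [mem_ball, dist_eq, lt_div_iff₀ (by positivity)] at hk
    have n1 := norm_nonneg (k.1.1 - g.1.1)
    have n2 := norm_nonneg (k.1.2 - g.1.2)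
    have h1 : ‖p.1.1 - f.1.1‖ ≤ ‖k.1.1 - g.1.1‖ := by
      refine norm_fst_sub_le n1 fun t ht => ?_
      rw [(hp t ht).1, add_sub_cancel_left, norm_smul, Real.norm_eq_abs]
      have := norm_path_sub_le k g t
      nlinarith [hχ1 t, norm_nonneg (k.path t - g.path t), abs_nonneg (χ t)]
    have h2 : ‖p.1.2 - f.1.2‖ ≤ ‖k.1.2 - g.1.2‖ + C * ‖k.1.1 - g.1.1‖ := by
      refine norm_snd_sub_le (by positivity) fun t ht => ?_
      rw [(hp t ht).2, add_sub_cancel_left]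
      refine (norm_add_le _ _).trans (add_le_add ?_ ?_)
      · rw [norm_smul, Real.norm_eq_abs]
        have := norm_velocity_sub_le k g t
        nlinarith [hχ1 t, norm_nonneg (k.velocity t - g.velocity t), abs_nonneg (χ t)]
      · rw [norm_smul, Real.norm_eq_abs]
        exact mul_le_mul (hC t ht) (norm_path_sub_le k g t) (norm_nonneg _) hC0
    rw [mem_ball, dist_eq]
    nlinarith [mul_nonneg hC0 n2]
  · rw [(hp t ht).1, hχA t htA, zero_smul, add_zero]
  · rw [(hp t ht).1, hχW t htW, one_smul, hfg t ht htW]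
    abel

/-- If `g` agrees with `f` off a closed set `A`, and all curves near `g` avoid `E` on `J ⊆ A`,
then passing from `f` to `g` replaces the contribution of `A` by at most that of `A \ J`. -/
lemma exists_ball_volume_times_le {E : Set H} {f g : Gamma1 H} {A J : Set ℝ} (hA : IsClosed A)
    (hA1 : A ⊆ Icc 0 1) (hJ : MeasurableSet J) (hJA : J ⊆ A)
    (hfg : ∀ t ∈ Icc (0:ℝ) 1, t ∉ A → g.path t = f.path t) {σ₀ σ₁ b ξ : ℝ} (hσ₀ : 0 < σ₀)
    (hσ₁ : 0 < σ₁) (hξ : 0 < ξ) (hb : ∀ p ∈ ball f σ₀, volume.real (p.times E) ≤ b)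
    (hgJ : ∀ k ∈ ball g σ₁, ∀ t ∈ J, k.path t ∉ E) :
    ∃ σ > 0, ∀ k ∈ ball g σ, volume.real (k.times E) ≤
      b + ξ - volume.real (f.times E ∩ A) + (volume.real A - volume.real J) := by
  have hAfin : volume A ≠ ∞ := measure_ne_top_of_subset hA1 (by simp)
  obtain ⟨W, hAW, hWo, hW⟩ := A.exists_isOpen_lt_add hAfin
    (ENNReal.ofReal_pos.2 hξ).ne'
  have hWA : volume.real (W \ A) ≤ ξ := by
    rw [measureReal_def, measure_sdiff hAW hA.measurableSet.nullMeasurableSet hAfin]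
    refine ENNReal.toReal_le_of_le_ofReal hξ.le ?_
    rw [tsub_le_iff_left]
    exact hW.le
  have hWfin : volume (W \ A) ≠ ∞ := measure_ne_top_of_subset sdiff_subset (hW.trans (by
    simp [hAfin.lt_top])).ne
  obtain ⟨σ, hσ, hglue⟩ := exists_glue hA hWo hAW
    (fun t ht htW => hfg t ht fun h => htW (hAW h)) hσ₀
  refine ⟨min σ σ₁, lt_min hσ hσ₁, fun k hk => ?_⟩
  obtain ⟨p, hp, hpA, hpW⟩ := hglue k (ball_subset_ball (min_le_left _ _) hk)
  have hfin : ∀ q : Gamma1 H, volume (q.times E) ≠ ∞ := fun q =>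
    ((q.volume_times_le E).trans_lt ENNReal.one_lt_top).ne
  have h1 : volume.real (f.times E ∩ A) + volume.real (k.times E \ W) ≤ b := by
    refine le_trans ?_ (hb p hp)
    rw [← measureReal_inter_add_sdiff hA.measurableSet (hfin p)]
    refine add_le_add (measureReal_mono ?_ (measure_ne_top_of_subset inter_subset_left (hfin p)))
      (measureReal_mono ?_ (measure_ne_top_of_subset sdiff_subset (hfin p)))
    · rintro t ⟨⟨ht, htE⟩, htA⟩
      exact ⟨⟨ht, by rwa [hpA t ht htA]⟩, htA⟩
    · rintro t ⟨⟨ht, htE⟩, htW⟩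
      exact ⟨⟨ht, by rwa [hpW t ht htW]⟩, fun h => htW (hAW h)⟩
  have hsub : k.times E ⊆ (k.times E \ W) ∪ ((W \ A) ∪ (A \ J)) := by
    rintro t ⟨ht, htE⟩
    have := fun h => hgJ k (ball_subset_ball (min_le_right _ _) hk) t h htE
    have hk : t ∈ k.times E := ⟨ht, htE⟩
    simp only [mem_union, mem_sdiff]
    tauto
  have h2 : volume.real (A \ J) = volume.real A - volume.real J :=
    measureReal_sdiff hJA hJ hAfin
  have h3 := measureReal_mono (μ := volume) hsub (by
    simp only [ne_eq, measure_union_eq_top_iff, not_or]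
    exact ⟨measure_ne_top_of_subset sdiff_subset (hfin k), hWfin,
      measure_ne_top_of_subset sdiff_subset hAfin⟩)
  have h4 := measureReal_union_le (μ := volume) (k.times E \ W) ((W \ A) ∪ (A \ J))
  have h5 := measureReal_union_le (μ := volume) (W \ A) (A \ J)
  linarith

end Glue

end Gamma1

section BumpSum

variable {H : Type*} [NormedAddCommGroup H] [NormedSpace ℝ H]

/-- The sum of the rescaled bumps `ψ ((τ - x) / w x) • v x` over `x ∈ T`. -/
def bumpSum (ψ : ℝ → ℝ) (T : Finset ℝ) (w : ℝ → ℝ) (v : ℝ → H) (τ : ℝ) : H :=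
  ∑ x ∈ T, ψ ((τ - x) / w x) • v x

lemma hasDerivAt_bumpSum {ψ : ℝ → ℝ} (hψ : Differentiable ℝ ψ) (T : Finset ℝ) (w : ℝ → ℝ)
    (v : ℝ → H) (τ : ℝ) :
    HasDerivAt (bumpSum ψ T w v) (bumpSum (deriv ψ) T w (fun x => (w x)⁻¹ • v x) τ) τ := by
  refine HasDerivAt.fun_sum fun x _ => ?_
  have h1 : HasDerivAt (fun τ : ℝ => (τ - x) / w x) (w x)⁻¹ τ := by
    simpa using ((hasDerivAt_id τ).sub_const x).div_const (w x)
  have h2 := ((hψ ((τ - x) / w x)).hasDerivAt.comp τ h1).smul_const (v x)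
  simpa [smul_smul, Function.comp_def] using h2

lemma continuous_bumpSum {ψ : ℝ → ℝ} (hψ : Continuous ψ) (T : Finset ℝ) (w : ℝ → ℝ)
    (v : ℝ → H) : Continuous (bumpSum ψ T w v) := by
  unfold bumpSum
  fun_prop

variable {ψ : ℝ → ℝ} {T : Finset ℝ} {w : ℝ → ℝ} {v : ℝ → H}

lemma bump_eq_zero (hψ : ∀ x, 1 < |x| → ψ x = 0) (hw : ∀ x ∈ T, 0 < w x)
    {x τ : ℝ} (hx : x ∈ T) (h : τ ∉ closedBall x (w x)) :
    ψ ((τ - x) / w x) = 0 := by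
  refine hψ _ ?_
  rw [abs_div, abs_of_pos (hw x hx), one_lt_div (hw x hx)]
  simpa [Real.dist_eq] using h

lemma bumpSum_eq_zero (hψ : ∀ x, 1 < |x| → ψ x = 0) (hw : ∀ x ∈ T, 0 < w x)
    {τ : ℝ} (h : τ ∉ ⋃ x ∈ T, closedBall x (w x)) : bumpSum ψ T w v τ = 0 := by
  refine Finset.sum_eq_zero fun x hx => ?_
  rw [bump_eq_zero hψ hw hx fun h' => h (mem_biUnion hx h'), zero_smul]

lemma bumpSum_eq_single (hψ : ∀ x, 1 < |x| → ψ x = 0) (hw : ∀ x ∈ T, 0 < w x)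
    (hd : (T : Set ℝ).PairwiseDisjoint (fun x => closedBall x (w x)))
    {x τ : ℝ} (hx : x ∈ T) (h : τ ∈ closedBall x (w x)) :
    bumpSum ψ T w v τ = ψ ((τ - x) / w x) • v x := by
  refine Finset.sum_eq_single_of_mem x hx fun y hy hyx => ?_
  rw [bump_eq_zero hψ hw hy fun h' => (disjoint_left.1 (hd hy hx hyx) h' h), zero_smul]

end BumpSum

namespace Gamma1

section Improvement

variable {H : Type*} [NormedAddCommGroup H]

/-- Near almost every time of a set `G` of times at which `f` lies in the porous set `E`, there are
intervals of length proportional to the distance of a hole and on which `f` is mostly in `E`;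
finitely many disjoint ones cover a prescribed portion of `G`. -/
lemma exists_holes [NormedSpace ℝ H] {c : ℝ} {E : Set H} (hE : IsCPorous c E)
    (f : Gamma1 H) {δ η b : ℝ} (hδ : 0 < δ) (hη : 0 < η) (hb0 : 0 ≤ b) {G : Set ℝ}
    (hG : G ⊆ f.times E) (hb : ENNReal.ofReal b < volume G) {R : ℝ → ℝ} (hR : ∀ x ∈ G, 0 < R x) :
    ∃ (T : Finset ℝ) (w : ℝ → ℝ) (v : ℝ → H), (∀ x ∈ T, x ∈ G) ∧
      (∀ x ∈ T, 0 < w x ∧ w x < R x) ∧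
      (T : Set ℝ).PairwiseDisjoint (fun x => closedBall x (w x)) ∧
      b < volume.real (⋃ x ∈ T, closedBall x (w x)) ∧
      ∀ x ∈ T, ‖v x‖ = δ * w x ∧ ball (f.path x + v x) (c * (δ * w x)) ∩ E = ∅ ∧
        (1 - η) * (2 * w x) ≤ volume.real (f.times E ∩ closedBall x (w x)) := by
  set S := f.times E with hS
  set N : Set ℝ := {x | ¬ Filter.Tendsto (fun r => volume (S ∩ closedBall x r) /
    volume (closedBall x r)) (𝓝[>] 0) (𝓝 1)} with hN
  have hN0 : volume (N ∩ S) = 0 :=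
    le_antisymm ((Measure.le_restrict_apply _ _).trans
      (Besicovitch.ae_tendsto_measure_inter_div volume S).le) bot_le
  have hGN : volume G ≤ volume (G \ N) := by
    refine (measure_mono (t := (N ∩ S) ∪ (G \ N)) fun x hx => ?_).trans
      ((measure_union_le _ _).trans (by rw [hN0, zero_add]))
    by_cases h : x ∈ N
    · exact Or.inl ⟨h, hG hx⟩
    · exact Or.inr ⟨hx, h⟩
  let rad : ℝ → Set ℝ := fun x => {w | ∃ v : H, ‖v‖ = δ * w ∧
    ball (f.path x + v) (c * (δ * w)) ∩ E = ∅ ∧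
    (1 - η) * (2 * w) ≤ volume.real (S ∩ closedBall x w)}
  have hrad : ∀ x ∈ G \ N, ∀ ε > 0, (rad x ∩ Ioo 0 ε).Nonempty := by
    intro x hx ε hε
    have hdens : Filter.Tendsto (fun r => volume (S ∩ closedBall x r) /
        volume (closedBall x r)) (𝓝[>] 0) (𝓝 1) := not_not.1 hx.2
    have hev := hdens.eventually_const_lt (u := ENNReal.ofReal (1 - η)) (by simpa using hη)
    obtain ⟨r₀, hr₀, hr⟩ := mem_nhdsGT_iff_exists_Ioo_subset.1 hev
    obtain ⟨h, r, hrpos, hdist, hball, hrc⟩ := hE (f.path x) (hG hx.1).2 (δ * min ε r₀)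
      (mul_pos hδ (lt_min hε hr₀))
    have hdpos : 0 < dist (f.path x) h := by
      by_contra hd0
      have : dist (f.path x) h = 0 := le_antisymm (not_lt.1 hd0) dist_nonneg
      have hmem : f.path x ∈ ball h r ∩ E := ⟨by simpa [this] using hrpos, (hG hx.1).2⟩
      rw [hball] at hmem
      exact hmem
    have hw0 : 0 < dist (f.path x) h / δ := by positivity
    have hw1 : dist (f.path x) h / δ < min ε r₀ := by rwa [div_lt_iff₀' hδ]
    have hmul : δ * (dist (f.path x) h / δ) = dist (f.path x) h := by field_simp
    refine ⟨dist (f.path x) h / δ, ⟨h - f.path x, ?_, ?_, ?_⟩, hw0,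
      hw1.trans_le (min_le_left _ _)⟩
    · rw [hmul, dist_comm, dist_eq_norm]
    · rw [hmul, add_sub_cancel]
      exact subset_empty_iff.1 (hball ▸ inter_subset_inter_left _ (ball_subset_ball hrc.le))
    · generalize dist (f.path x) h / δ = w at hw0 hw1
      have h1 : ENNReal.ofReal (1 - η) < volume (S ∩ closedBall x w) / volume (closedBall x w) :=
        hr ⟨hw0, hw1.trans_le (min_le_right _ _)⟩
      have h2 := (ENNReal.le_div_iff_mul_le (Or.inl (measure_closedBall_pos _ _ hw0).ne')
        (Or.inl measure_closedBall_lt_top.ne)).1 h1.le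
      rw [Real.volume_closedBall, ← ENNReal.ofReal_mul' (by positivity)] at h2
      exact (ENNReal.ofReal_le_iff_le_toReal (measure_ne_top_of_subset inter_subset_right
        measure_closedBall_lt_top.ne)).1 h2
  obtain ⟨T, w, hTG, hw, hd, hTb⟩ := exists_finset_disjoint_closedBall (rad := rad)
    (hb.trans_le hGN) (R := R) hrad (fun x hx => hR x hx.1)
  have hwrad : ∀ x ∈ T, w x ∈ rad x := fun x hx => (hw x hx).1
  choose! v hv using hwrad
  refine ⟨T, w, v, fun x hx => (hTG x hx).1, fun x hx => (hw x hx).2, hd, ?_, hv⟩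
  exact (ENNReal.ofReal_lt_iff_lt_toReal hb0
      (measure_biUnion_lt_top T.finite_toSet fun _ _ => measure_closedBall_lt_top).ne).1 hTb

variable [InnerProductSpace ℝ H]

/-- Bumps with mean zero velocity, on intervals where `f.velocity - f₀.velocity` is almost
constant, change the energy only to second order. -/
lemma energy_le_of_bumpSum {f₀ f g : Gamma1 H} {ψ : ℝ → ℝ} {K δ η : ℝ} (hψ : ContDiff ℝ 1 ψ)
    (hK : ∀ x, |deriv ψ x| ≤ K) (hψ0 : ∀ x, 1 < |x| → ψ x = 0)
    (hψ0' : ∀ x, 1 < |x| → deriv ψ x = 0) {T : Finset ℝ} {w : ℝ → ℝ} {v : ℝ → H}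
    (hw : ∀ x ∈ T, 0 < w x) (hd : (T : Set ℝ).PairwiseDisjoint (fun x => closedBall x (w x)))
    (hsub : ∀ x ∈ T, closedBall x (w x) ⊆ Ioo 0 1) (hv : ∀ x ∈ T, ‖v x‖ ≤ δ * w x)
    (hosc : ∀ x ∈ T, ∀ t ∈ closedBall x (w x),
      ‖(f.velocity t - f₀.velocity t) - (f.velocity x - f₀.velocity x)‖ ≤ η)
    (hg : ∀ t ∈ Icc (0:ℝ) 1, g.velocity t = f.velocity t +
      bumpSum (deriv ψ) T w (fun x => (w x)⁻¹ • v x) t) :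
    energy g f₀ ≤ energy f f₀ + (2 * η * (K * δ) + (K * δ) ^ 2) *
      volume.real (⋃ x ∈ T, closedBall x (w x)) := by
  set A := ⋃ x ∈ T, closedBall x (w x) with hA
  have hA1 : A ⊆ Ioo 0 1 := iUnion₂_subset hsub
  have hAm : MeasurableSet A := T.measurableSet_biUnion fun _ _ => isClosed_closedBall.measurableSet
  set q : ℝ → H := fun t => f.velocity t - f₀.velocity t with hq
  set C := 2 * η * (K * δ) + (K * δ) ^ 2 with hC
  let u : ℝ → ℝ := fun x => 2 * inner ℝ (q x) (v x)
  let D : ℝ → ℝ := bumpSum (deriv ψ) T w (fun x => (w x)⁻¹ • u x)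
  have cf := f.continuous_velocity
  have cg := g.continuous_velocity
  have cf₀ := f₀.continuous_velocity
  have cD : Continuous D := continuous_bumpSum (hψ.continuous_deriv le_rfl) _ _ _
  have hD : ∫ t in (0:ℝ)..1, D t = 0 := by
    rw [intervalIntegral.integral_eq_sub_of_hasDerivAt
      (fun t _ => hasDerivAt_bumpSum (hψ.differentiable one_ne_zero) T w u t)
      (cD.intervalIntegrable _ _),
      bumpSum_eq_zero hψ0 hw fun h => lt_irrefl _ (hA1 h).2,
      bumpSum_eq_zero hψ0 hw fun h => lt_irrefl _ (hA1 h).1, sub_zero]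
  have hind : IntervalIntegrable (A.indicator fun _ => C) volume 0 1 :=
    ((integrable_indicator_iff hAm).2 (integrableOn_const
      (measure_ne_top_of_subset hA1 (by simp)))).intervalIntegrable
  have hindint : ∫ t in (0:ℝ)..1, A.indicator (fun _ => C) t = C * volume.real A := by
    rw [intervalIntegral.integral_of_le zero_le_one, setIntegral_indicator hAm,
      inter_eq_right.2 (hA1.trans Ioo_subset_Ioc_self), setIntegral_const, smul_eq_mul, mul_comm]
  have hqint : IntervalIntegrable (fun t => ‖q t‖ ^ 2) volume 0 1 :=
    Continuous.intervalIntegrable (by fun_prop) _ _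
  have key : energy f f₀ + C * volume.real A =
      ∫ t in (0:ℝ)..1, (‖q t‖ ^ 2 + A.indicator (fun _ => C) t + D t) := by
    rw [intervalIntegral.integral_add (hqint.add hind) (cD.intervalIntegrable _ _),
      intervalIntegral.integral_add hqint hind, hD, hindint, add_zero]
    rfl
  rw [key]
  refine intervalIntegral.integral_mono_on zero_le_one
    (Continuous.intervalIntegrable (by fun_prop) _ _)
    ((hqint.add hind).add (cD.intervalIntegrable _ _)) fun t ht => ?_
  rw [hg t ht, add_sub_right_comm]
  change ‖q t + _‖ ^ 2 ≤ _
  by_cases htA : t ∈ A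
  · obtain ⟨x, hx, htx⟩ := mem_iUnion₂.1 htA
    rw [indicator_of_mem htA, bumpSum_eq_single hψ0' hw hd hx htx]
    simp only [D]
    rw [bumpSum_eq_single hψ0' hw hd hx htx]
    set φ : H := deriv ψ ((t - x) / w x) • (w x)⁻¹ • v x with hφ
    have hwx := hw x hx
    have h1 : deriv ψ ((t - x) / w x) • (w x)⁻¹ • u x = 2 * inner ℝ (q x) φ := by
      simp only [hφ, u, inner_smul_right, smul_eq_mul]
      ring
    have h2 : ‖φ‖ ≤ K * δ := by
      rw [hφ, norm_smul, norm_smul, norm_inv, Real.norm_of_nonneg hwx.le]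
      refine mul_le_mul (hK _) ?_ (by positivity) ((abs_nonneg _).trans (hK 0))
      rw [inv_mul_le_iff₀ hwx, mul_comm]
      exact hv x hx
    have h3 : inner ℝ (q t - q x) φ ≤ η * (K * δ) :=
      (real_inner_le_norm _ _).trans (mul_le_mul (hosc x hx t htx) h2 (norm_nonneg _)
        ((norm_nonneg _).trans (hosc x hx t htx)))
    rw [h1, norm_add_sq_real]
    rw [inner_sub_left] at h3
    have h4 : ‖φ‖ ^ 2 ≤ (K * δ) ^ 2 := pow_le_pow_left₀ (norm_nonneg _) h2 2
    linarith
  · rw [indicator_of_notMem htA, bumpSum_eq_zero hψ0' hw htA]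
    simp only [D]
    rw [bumpSum_eq_zero hψ0' hw htA]
    simp

lemma volume_good_times {E : Set H} {f₀ f : Gamma1 H} {ρ s : ℝ} (hρ : 0 < ρ) (hs0 : 0 < s)
    (hs : s / 2 < volume.real (f.times E)) (he : energy f f₀ ≤ s * ρ ^ 2 / 128) :
    ENNReal.ofReal (s / 8) < volume ((f.times E ∩ Ioo 0 1) \
      {t ∈ Icc (0:ℝ) 1 | ρ / 4 ≤ ‖f.velocity t - f₀.velocity t‖}) := by
  set B : Set ℝ := {t ∈ Icc (0:ℝ) 1 | ρ / 4 ≤ ‖f.velocity t - f₀.velocity t‖} with hB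
  set G : Set ℝ := (f.times E ∩ Ioo 0 1) \ B with hG
  have hBvol : volume.real B ≤ s / 8 := by
    have h := mul_volume_velocity_ge_le f f₀ (a := ρ / 4) (by positivity)
    have h' : (ρ / 4) ^ 2 * volume.real B ≤ (ρ / 4) ^ 2 * (s / 8) := by
      refine h.trans (he.trans (le_of_eq (by ring)))
    exact le_of_mul_le_mul_left h' (by positivity)
  have hBfin : volume B ≠ ∞ := measure_ne_top_of_subset (fun t ht => ht.1)
    (measure_Icc_lt_top (μ := volume) (a := (0:ℝ)) (b := 1)).ne
  have hGfin : volume G ≠ ∞ := measure_ne_top_of_subset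
    (fun t ht => ht.1.2) (measure_Ioo_lt_top (μ := volume) (a := (0:ℝ)) (b := 1)).ne
  have hsub : f.times E ⊆ G ∪ (B ∪ {0, 1}) := by
    intro t ht
    have h01 : t ∈ Ioo (0:ℝ) 1 ∨ t ∈ ({0, 1} : Set ℝ) := by
      rcases ht.1.1.eq_or_lt with h | h
      · exact Or.inr (Or.inl h.symm)
      · rcases ht.1.2.eq_or_lt with h' | h'
        · exact Or.inr (Or.inr h')
        · exact Or.inl ⟨h, h'⟩
    simp only [hG, mem_union, mem_sdiff, mem_inter_iff]
    tauto
  have h0 : volume.real ({0, 1} : Set ℝ) = 0 := by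
    rw [measureReal_def, (Set.toFinite _).measure_zero, ENNReal.toReal_zero]
  have hfin01 : volume ({0, 1} : Set ℝ) ≠ ∞ := by
    rw [(Set.toFinite _).measure_zero]; exact ENNReal.zero_ne_top
  have h1 := measureReal_mono (μ := volume) hsub (by
    simp only [ne_eq, measure_union_eq_top_iff, not_or]
    exact ⟨hGfin, hBfin, hfin01⟩)
  have h2 := measureReal_union_le (μ := volume) G (B ∪ {0, 1})
  have h3 := measureReal_union_le (μ := volume) B {0, 1}
  refine (ENNReal.ofReal_lt_iff_lt_toReal (by positivity) hGfin).2 ?_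
  change s / 8 < volume.real G
  linarith

set_option maxHeartbeats 400000 in
/-- If `f` spends time more than `s / 2` in `E`, then a bump perturbation of `f` of small slope
lowers the bound for the time spent in `E` by more than it raises the energy. -/
lemma exists_improvement {c : ℝ} {E : Set H} (hE : IsCPorous c E) (hc : c ∈ Ioo (0:ℝ) 1)
    {f₀ f : Gamma1 H} {ψ : ℝ → ℝ} {K L δ κ l ρ s σ₀ b : ℝ} (hψ : ContDiff ℝ 1 ψ)
    (hψ1 : ∀ x, |ψ x| ≤ 1) (hK0 : 0 < K) (hK : ∀ x, |deriv ψ x| ≤ K)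
    (hψc : ∀ x, |x| ≤ 1 / 2 → ψ x = 1) (hψ0 : ∀ x, 1 < |x| → ψ x = 0)
    (hψ0' : ∀ x, 1 < |x| → deriv ψ x = 0) (hL1 : 1 ≤ L) (hL : ∀ t, ‖f.velocity t‖ ≤ L)
    (hδ : 0 < δ) (hδ1 : δ ≤ 1) (hKδ : K * δ ≤ ρ / 16) (hκ : κ = c * δ / (2 * L)) (hl : 0 < l)
    (hlκ : l * (K * δ) ^ 2 ≤ κ / 4) (hρ : 0 < ρ) (hf1 : ‖f.1.1 - f₀.1.1‖ < ρ / 2)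
    (hf2 : ‖f.1.2 - f₀.1.2‖ < ρ / 2) (hs0 : 0 < s) (hs : s / 2 < volume.real (f.times E))
    (he : energy f f₀ ≤ s * ρ ^ 2 / 128) (hσ₀ : 0 < σ₀)
    (hb : ∀ p ∈ ball f σ₀, volume.real (p.times E) ≤ b) :
    ∃ (g : Gamma1 H) (σ b' : ℝ), ‖g.1.1 - f₀.1.1‖ < ρ / 2 ∧ ‖g.1.2 - f₀.1.2‖ < ρ / 2 ∧ 0 < σ ∧
      (∀ k ∈ ball g σ, volume.real (k.times E) ≤ b') ∧
      b' + l * energy g f₀ ≤ b + l * energy f f₀ - κ * s / 32 := by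
  obtain ⟨hc0, hc1⟩ := hc
  have hκ0 : 0 < κ := by rw [hκ]; positivity
  have hκL : L * κ = c * δ / 2 := by rw [hκ]; field_simp
  have hκ2 : κ ≤ 1 / 2 := by nlinarith [mul_le_mul hc1.le hδ1 hδ.le zero_le_one]
  set q : ℝ → H := fun t => f.velocity t - f₀.velocity t with hq
  have cf := f.continuous_velocity
  have cf₀ := f₀.continuous_velocity
  have cq : Continuous q := by fun_prop
  obtain ⟨η, hη, hηρ, hηκ⟩ : ∃ η > 0, η ≤ ρ / 16 ∧ l * (2 * η * (K * δ)) ≤ κ / 8 := by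
    refine ⟨min (ρ / 16) (κ / (16 * (l * (K * δ)))), by positivity, min_le_left _ _, ?_⟩
    have h := min_le_right (ρ / 16) (κ / (16 * (l * (K * δ))))
    rw [le_div_iff₀ (by positivity)] at h
    linarith
  obtain ⟨R₀, hR₀, hosc⟩ : ∃ R₀ > 0, ∀ x ∈ Icc (0:ℝ) 1, ∀ t ∈ Icc (0:ℝ) 1, dist t x < R₀ →
      ‖q t - q x‖ ≤ η := by
    obtain ⟨R₀, hR₀, h⟩ := Metric.uniformContinuousOn_iff.1
      (isCompact_Icc.uniformContinuousOn_of_continuous cq.continuousOn) η hη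
    exact ⟨R₀, hR₀, fun x hx t ht htx => by
      rw [← dist_eq_norm]; exact (h t ht x hx htx).le⟩
  set m := (ρ / 2 - ‖f.1.1 - f₀.1.1‖) / 2 with hm
  have hm0 : 0 < m := by rw [hm]; linarith
  -- the times at which a bump may be placed
  set B : Set ℝ := {t ∈ Icc (0:ℝ) 1 | ρ / 4 ≤ ‖q t‖} with hB
  set G : Set ℝ := (f.times E ∩ Ioo 0 1) \ B with hG
  have hGvol : ENNReal.ofReal (s / 8) < volume G := volume_good_times hρ hs0 hs he
  obtain ⟨T, w, v, hTG, hw, hd, hTvol, hhole⟩ := exists_holes hE f (η := κ / 4) hδ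
    (by positivity) (by positivity) (fun t ht => ht.1.1) hGvol
    (R := fun t => min (min t (1 - t)) (min R₀ m))
    (fun t ht => lt_min (lt_min ht.1.2.1 (by linarith [ht.1.2.2])) (lt_min hR₀ hm0))
  simp only [lt_min_iff] at hw
  have hw0 : ∀ x ∈ T, 0 < w x := fun x hx => (hw x hx).1
  set A := ⋃ x ∈ T, closedBall x (w x) with hA
  set J := ⋃ x ∈ T, closedBall x (κ * w x) with hJ
  have hκw : ∀ x ∈ T, κ * w x ≤ w x := fun x hx => by nlinarith [hw0 x hx]
  have hsub : ∀ x ∈ T, closedBall x (w x) ⊆ Ioo 0 1 := by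
    intro x hx t ht
    rw [mem_closedBall, Real.dist_eq, abs_le] at ht
    obtain ⟨-, ⟨h1, h2⟩, -⟩ := hw x hx
    exact ⟨by linarith [ht.1], by linarith [ht.2]⟩
  have hA1 : A ⊆ Ioo 0 1 := iUnion₂_subset hsub
  have hAc : IsClosed A := T.finite_toSet.isClosed_biUnion fun _ _ => isClosed_closedBall
  have hJc : IsClosed J := T.finite_toSet.isClosed_biUnion fun _ _ => isClosed_closedBall
  have hJA : J ⊆ A := iUnion₂_mono fun x hx => closedBall_subset_closedBall (hκw x hx)
  have hAvol : volume.real A = ∑ x ∈ T, 2 * w x :=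
    volume_real_biUnion_closedBall (fun x hx => (hw0 x hx).le) hd
  have hJvol : volume.real J = κ * volume.real A := by
    rw [hAvol, Finset.mul_sum, volume_real_biUnion_closedBall
      (fun x hx => (mul_pos hκ0 (hw0 x hx)).le) (hd.mono_on fun x hx =>
        closedBall_subset_closedBall (hκw x hx))]
    exact Finset.sum_congr rfl fun x _ => by ring
  have hEA : (1 - κ / 4) * volume.real A ≤ volume.real (f.times E ∩ A) := by
    rw [hAvol, Finset.mul_sum]
    refine (Finset.sum_le_sum fun x hx => (hhole x hx).2.2).trans
      (sum_volume_real_inter_closedBall _ hd).le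
  have hx01 : ∀ x ∈ T, x ∈ Icc (0:ℝ) 1 := fun x hx => Ioo_subset_Icc_self (hTG x hx).1.2
  have hoscT : ∀ x ∈ T, ∀ t ∈ closedBall x (w x), ‖q t - q x‖ ≤ η := fun x hx t ht =>
    hosc x (hx01 x hx) t (Ioo_subset_Icc_self (hsub x hx ht))
      ((mem_closedBall.1 ht).trans_lt (hw x hx).2.2.1)
  -- the perturbed curve
  have cp := f.continuous_path
  have cb := continuous_bumpSum hψ.continuous T w v
  have cb' := continuous_bumpSum (hψ.continuous_deriv le_rfl) T w (fun x => (w x)⁻¹ • v x)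
  obtain ⟨g, hg⟩ := exists_of_hasDerivWithinAt (F := fun t => f.path t + bumpSum ψ T w v t)
    (F' := fun t => f.velocity t + bumpSum (deriv ψ) T w (fun x => (w x)⁻¹ • v x) t)
    (by fun_prop) (by fun_prop) fun t ht => (f.hasDerivWithinAt_path ht).add
      (hasDerivAt_bumpSum (hψ.differentiable one_ne_zero) T w v t).hasDerivWithinAt
  have hg1 : ‖g.1.1 - f₀.1.1‖ < ρ / 2 := by
    refine (norm_fst_sub_le (a := ‖f.1.1 - f₀.1.1‖ + m) (by positivity) fun t ht => ?_).trans_lt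
      (by linarith)
    rw [(hg t ht).1, add_sub_right_comm]
    refine (norm_add_le _ _).trans (add_le_add (norm_path_sub_le f f₀ t) ?_)
    by_cases htA : t ∈ A
    · obtain ⟨x, hx, htx⟩ := mem_iUnion₂.1 htA
      rw [bumpSum_eq_single hψ0 hw0 hd hx htx, norm_smul, (hhole x hx).1, Real.norm_eq_abs]
      have h1 := hψ1 ((t - x) / w x)
      have h2 : δ * w x ≤ m := by nlinarith [hw0 x hx, (hw x hx).2.2.2]
      nlinarith [abs_nonneg (ψ ((t - x) / w x)), mul_pos hδ (hw0 x hx)]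
    · rw [bumpSum_eq_zero hψ0 hw0 htA, norm_zero]
      exact hm0.le
  have hg2 : ‖g.1.2 - f₀.1.2‖ < ρ / 2 := by
    refine (norm_snd_sub_le (a := max ‖f.1.2 - f₀.1.2‖ (3 * ρ / 8)) (by positivity)
      fun t ht => ?_).trans_lt (max_lt hf2 (by linarith))
    rw [(hg t ht).2, add_sub_right_comm]
    by_cases htA : t ∈ A
    · refine le_max_of_le_right ((norm_add_le _ _).trans ?_)
      obtain ⟨x, hx, htx⟩ := mem_iUnion₂.1 htA
      have hwx := hw0 x hx
      have h1 : ‖q x‖ < ρ / 4 := by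
        by_contra h
        exact (hTG x hx).2 ⟨hx01 x hx, not_lt.1 h⟩
      have h2 := hoscT x hx t htx
      have h3 : ‖q t‖ ≤ ‖q t - q x‖ + ‖q x‖ := by
        simpa using norm_add_le (q t - q x) (q x)
      rw [bumpSum_eq_single hψ0' hw0 hd hx htx, norm_smul, norm_smul, (hhole x hx).1, norm_inv,
        Real.norm_of_nonneg hwx.le, Real.norm_eq_abs]
      have h4 : (w x)⁻¹ * (δ * w x) = δ := by field_simp
      have h5 := mul_le_mul_of_nonneg_right (hK ((t - x) / w x)) hδ.le
      rw [h4]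
      change ‖q t‖ + _ ≤ _
      linarith
    · refine le_max_of_le_left ?_
      rw [bumpSum_eq_zero hψ0' hw0 htA, add_zero]
      exact norm_velocity_sub_le f f₀ t
  have henergy := energy_le_of_bumpSum hψ hK hψ0 hψ0' hw0 hd hsub
    (fun x hx => (hhole x hx).1.le) hoscT fun t ht => (hg t ht).2
  -- curves near `g` stay in the holes
  obtain ⟨σ₁, hσ₁T, hσ₁⟩ : ∃ σ₁ : ℝ, (∀ x ∈ T, σ₁ < c * δ * w x / 2) ∧ 0 < σ₁ := by
    refine (((Filter.eventually_all_finset T).2 fun x hx => ?_).and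
      (self_mem_nhdsWithin (a := (0:ℝ)) (s := Ioi 0))).exists
    have := hw0 x hx
    exact nhdsWithin_le_nhds (gt_mem_nhds (by positivity))
  obtain ⟨σ, hσ, hbound⟩ := exists_ball_volume_times_le (E := E) (f := f) (g := g) (J := J) hAc
    (hA1.trans Ioo_subset_Icc_self) hJc.measurableSet hJA
    (fun t ht htA => by rw [(hg t ht).1, bumpSum_eq_zero hψ0 hw0 htA, add_zero])
    hσ₀ hσ₁ (ξ := κ * s / 64) (by positivity) hb fun k hk t htJ htE => by
      have ht01 : t ∈ Icc (0:ℝ) 1 := Ioo_subset_Icc_self (hA1 (hJA htJ))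
      obtain ⟨x, hx, htx⟩ := mem_iUnion₂.1 htJ
      have hwx := hw0 x hx
      have htx' : |t - x| ≤ κ * w x := by simpa [Real.dist_eq] using htx
      have h1 : g.path t = f.path t + v x := by
        rw [(hg t ht01).1, bumpSum_eq_single hψ0 hw0 hd hx
          (closedBall_subset_closedBall (hκw x hx) htx), hψc, one_smul]
        rw [abs_div, abs_of_pos hwx, div_le_iff₀ hwx]
        nlinarith
      have h2 := f.norm_path_sub_path_le hL (hx01 x hx) ht01
      have h3 : ‖k.path t - g.path t‖ < σ₁ := by
        refine (norm_path_sub_le k g t).trans_lt (lt_of_le_of_lt ?_ (mem_ball.1 hk))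
        rw [dist_eq]
        linarith [norm_nonneg (k.1.2 - g.1.2)]
      have h4 : L * |t - x| ≤ c * δ * w x / 2 := by
        calc L * |t - x| ≤ L * (κ * w x) := by gcongr
          _ = c * δ * w x / 2 := by rw [← mul_assoc, hκL]; ring
      have hmem : k.path t ∈ ball (f.path x + v x) (c * (δ * w x)) ∩ E := by
        refine ⟨?_, htE⟩
        rw [mem_ball, dist_eq_norm]
        have h5 : k.path t - (f.path x + v x) = (k.path t - g.path t) + (f.path t - f.path x) := by
          rw [h1]; abel
        rw [h5]
        have h6 := norm_add_le (k.path t - g.path t) (f.path t - f.path x)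
        have h7 := hσ₁T x hx
        linarith
      rw [(hhole x hx).2.1] at hmem
      exact hmem
  refine ⟨g, σ, _, hg1, hg2, hσ, hbound, ?_⟩
  rw [hJvol]
  have hA0 : 0 ≤ volume.real A := measureReal_nonneg
  have e1 := mul_le_mul_of_nonneg_left henergy hl.le
  have e2 := mul_le_mul_of_nonneg_right hlκ hA0
  have e3 := mul_le_mul_of_nonneg_right hηκ hA0
  have e4 := mul_le_mul_of_nonneg_left hTvol.le hκ0.le
  linarith

end Improvement

end Gamma1

/-- If `E ⊆ H` is `c`-porous with `c ∈ (0,1)`, then inside every open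
ball `U` of `Γ₁(H)` there is an open ball `V ⊆ U` with
`sup_{f ∈ V} |f⁻¹(E)| ≤ (1/2) · sup_{f ∈ U} |f⁻¹(E)|`. -/
theorem exists_ball_of_cPorous {H : Type*} [NormedAddCommGroup H]
    [InnerProductSpace ℝ H] [CompleteSpace H] {c : ℝ} (hc : c ∈ Ioo (0:ℝ) 1)
    {E : Set H} (hE : IsCPorous c E) (f₀ : Gamma1 H) {ρ : ℝ} (hρ : 0 < ρ) :
    ∃ g₀ : Gamma1 H, ∃ σ : ℝ, 0 < σ ∧ Metric.ball g₀ σ ⊆ Metric.ball f₀ ρ ∧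
      (⨆ f ∈ Metric.ball g₀ σ, Gamma1.measOn f E) ≤
        (1 / 2) * ⨆ f ∈ Metric.ball f₀ ρ, Gamma1.measOn f E := by
  set M := ⨆ f ∈ ball f₀ ρ, Gamma1.measOn f E with hM
  have hM1 : M ≤ 1 := iSup₂_le fun f _ => by
    rw [Gamma1.measOn_eq]; exact f.volume_times_le E
  have hMfin : M ≠ ∞ := (hM1.trans_lt ENNReal.one_lt_top).ne
  by_cases hM0 : M = 0
  · exact ⟨f₀, ρ, hρ, Subset.rfl, by rw [← hM, hM0]; exact zero_le⟩
  set s := M.toReal with hs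
  have hs0 : 0 < s := ENNReal.toReal_pos hM0 hMfin
  have hle : ∀ k ∈ ball f₀ ρ, volume.real (k.times E) ≤ s := fun k hk => by
    refine ENNReal.toReal_mono hMfin ?_
    rw [← Gamma1.measOn_eq]
    exact le_iSup₂ (f := fun f (_ : f ∈ ball f₀ ρ) => Gamma1.measOn f E) k hk
  by_contra! hcon
  have hlarge : ∀ (g : Gamma1 H) (σ : ℝ), 0 < σ → ball g σ ⊆ ball f₀ ρ →
      ∃ k ∈ ball g σ, s / 2 < volume.real (k.times E) := by
    intro g σ hσ hsub
    obtain ⟨k, hk, hlt⟩ := lt_biSup_iff.1 (hcon g σ hσ hsub)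
    refine ⟨k, hk, ?_⟩
    rw [Gamma1.measOn_eq] at hlt
    have := ENNReal.toReal_strict_mono
      ((k.volume_times_le E).trans_lt ENNReal.one_lt_top).ne hlt
    rw [ENNReal.toReal_mul] at this
    calc s / 2 = (1 / 2 : ℝ≥0∞).toReal * M.toReal := by rw [hs]; simp; ring
      _ < _ := this
  obtain ⟨ψ, K, hK1, hψ, hψ1, hK, hψc, hψ0, hψ0'⟩ := exists_bump
  obtain ⟨hc0, hc1⟩ := id hc
  have hK0 : 0 < K := by linarith
  set L := ‖f₀.1.2‖ + ρ + 1 with hL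
  have hL1 : 1 ≤ L := by rw [hL]; linarith [norm_nonneg f₀.1.2]
  set l := 256 / ρ ^ 2 with hl
  have hl0 : 0 < l := by positivity
  obtain ⟨δ, hδ, hδ1, hKδ, hδl⟩ : ∃ δ > 0, δ ≤ 1 ∧ K * δ ≤ ρ / 16 ∧
      l * (K * δ) ^ 2 ≤ c * δ / (2 * L) / 4 := by
    refine ⟨min 1 (min (ρ / 16 / K) (c / (8 * L * (l * K ^ 2)))), by positivity, min_le_left _ _,
      ?_, ?_⟩
    · rw [← le_div_iff₀' hK0]
      exact (min_le_right _ _).trans (min_le_left _ _)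
    · set δ := min 1 (min (ρ / 16 / K) (c / (8 * L * (l * K ^ 2)))) with hδ
      have hδ0 : 0 < δ := by positivity
      have h : δ ≤ c / (8 * L * (l * K ^ 2)) := (min_le_right _ _).trans (min_le_right _ _)
      rw [le_div_iff₀ (by positivity)] at h
      rw [div_div, le_div_iff₀ (by positivity)]
      nlinarith
  set κ := c * δ / (2 * L) with hκ
  have hκ0 : 0 < κ := by positivity
  -- the achievable values of the sum of the time bound and the weighted energy
  let S : Set ℝ := {x | ∃ (f : Gamma1 H) (σ b : ℝ), ‖f.1.1 - f₀.1.1‖ < ρ / 2 ∧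
    ‖f.1.2 - f₀.1.2‖ < ρ / 2 ∧ 0 < σ ∧ (∀ k ∈ ball f σ, volume.real (k.times E) ≤ b) ∧
    x = b + l * Gamma1.energy f f₀}
  have hS0 : s ∈ S := ⟨f₀, ρ, s, by simpa using hρ, by simpa using hρ, hρ, hle, by
    simp [Gamma1.energy]⟩
  have hSb : BddBelow S := by
    refine ⟨0, ?_⟩
    rintro x ⟨f, σ, b, -, -, hσ, hb, rfl⟩
    have h1 := measureReal_nonneg.trans (hb f (mem_ball_self hσ))
    have h2 := mul_nonneg hl0.le (Gamma1.energy_nonneg f f₀)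
    linarith
  set γ := min (κ * s / 128) (s / 2) with hγ
  have hγ0 : 0 < γ := by positivity
  have hγκ : γ ≤ κ * s / 128 := min_le_left _ _
  have hγs : γ ≤ s / 2 := min_le_right _ _
  obtain ⟨x, ⟨f, σ, b, hf1, hf2, hσ, hb, rfl⟩, hx⟩ :=
    exists_lt_of_csInf_lt ⟨s, hS0⟩ (lt_add_of_pos_right (sInf S) hγ0)
  have hinf : sInf S ≤ s := csInf_le hSb hS0
  -- a nearby curve spending a long time in `E`
  obtain ⟨r, ⟨hr1, hr2, hrσ, hre⟩, hr⟩ : ∃ r : ℝ, (‖f.1.1 - f₀.1.1‖ + r < ρ / 2 ∧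
      ‖f.1.2 - f₀.1.2‖ + r < ρ / 2 ∧ r < σ ∧ l * (2 * (ρ / 2) * r + r ^ 2) < γ) ∧ 0 < r := by
    have hlim : ∀ {F : ℝ → ℝ} {a : ℝ}, Continuous F → F 0 < a → ∀ᶠ r in 𝓝[>] (0:ℝ), F r < a :=
      fun hF ha => nhdsWithin_le_nhds (hF.continuousAt.eventually_lt_const ha)
    exact (((hlim (by fun_prop) (by simpa using hf1)).and
      ((hlim (by fun_prop) (by simpa using hf2)).and ((hlim (F := fun r => r) (by fun_prop) hσ).and
        (hlim (F := fun r => l * (2 * (ρ / 2) * r + r ^ 2)) (by fun_prop)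
          (by simpa using hγ0))))).and self_mem_nhdsWithin).exists
  have hdist : ∀ k ∈ ball f r, ‖k.1.1 - f.1.1‖ < r ∧ ‖k.1.2 - f.1.2‖ < r := by
    intro k hk
    rw [mem_ball, Gamma1.dist_eq] at hk
    exact ⟨by linarith [norm_nonneg (k.1.2 - f.1.2)], by linarith [norm_nonneg (k.1.1 - f.1.1)]⟩
  have hD : ∀ k ∈ ball f r, ‖k.1.1 - f₀.1.1‖ < ρ / 2 ∧ ‖k.1.2 - f₀.1.2‖ < ρ / 2 := by
    intro k hk
    have h1 := norm_sub_le_norm_sub_add_norm_sub k.1.1 f.1.1 f₀.1.1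
    have h2 := norm_sub_le_norm_sub_add_norm_sub k.1.2 f.1.2 f₀.1.2
    exact ⟨by linarith [hdist k hk], by linarith [hdist k hk]⟩
  obtain ⟨k, hk, hks⟩ := hlarge f r hr fun k hk => by
    rw [mem_ball, Gamma1.dist_eq]
    linarith [hD k hk]
  have hke : l * Gamma1.energy k f₀ ≤ l * Gamma1.energy f f₀ + γ := by
    have := mul_le_mul_of_nonneg_left
      (Gamma1.energy_le_add hf2.le (hdist k hk).2.le) hl0.le
    linarith
  have hb0 : 0 ≤ b := measureReal_nonneg.trans (hb f (mem_ball_self hσ))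
  have hkσ : 0 < σ - dist k f := by linarith [mem_ball.1 hk]
  obtain ⟨g, σ', b', hg1, hg2, hσ', hgb, hlt⟩ := Gamma1.exists_improvement hE hc (f₀ := f₀)
    (f := k) hψ hψ1 hK0 hK hψc (fun x hx => hψ0 x hx.le) hψ0' hL1 (fun t => by
      have h1 := Gamma1.norm_velocity_sub_le k f₀ t
      have h2 := f₀.1.2.norm_coe_le_norm (projIcc 0 1 zero_le_one t)
      have h3 := norm_le_norm_sub_add (k.velocity t) (f₀.velocity t)
      have h4 : ‖f₀.velocity t‖ ≤ ‖f₀.1.2‖ := h2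
      linarith [(hD k hk).2]) hδ hδ1 hKδ hκ hl0 hδl hρ (hD k hk).1 (hD k hk).2 hs0 hks (by
      have h1 : l * Gamma1.energy k f₀ ≤ 2 * s := by linarith
      rw [hl, div_mul_eq_mul_div, div_le_iff₀ (by positivity)] at h1
      linarith) hkσ (b := b) fun p hp => hb p (by
        rw [mem_ball] at hp ⊢
        linarith [dist_triangle p k f])
  have hmem : b' + l * Gamma1.energy g f₀ ∈ S := ⟨g, σ', b', hg1, hg2, hσ', hgb, rfl⟩
  have := csInf_le hSb hmem
  have : 0 < κ * s := by positivity
  linarith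

end
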